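/- An integral domain D is t-sharp if and only if the polynomial ring D[X] is t-sharp. -/

import Mathlib

open scoped nonZeroDivisors

section StarSharpDefs

variable {D K : Type*} [CommRing D] [IsDomain D] [Field K] [Algebra D K] [IsFractionRing D K]

/-- `D` is sharp with respect to the operation `star` ("`*`-sharp"): whenever
`I ⊇ A·B` for nonzero ideals `I, A, B` of `D`, there exist nonzero ideals `H, J`
with `I* = (HJ)*`, `H* ⊇ A` and `J* ⊇ B`. -/
def IsSharpOp (star : FractionalIdeal D⁰ K → FractionalIdeal D⁰ K) : Prop :=
  ∀ I A B : Ideal D, I ≠ 0 → A ≠ 0 → B ≠ 0 → A * B ≤ I →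
    ∃ H J : Ideal D, H ≠ 0 ∧ J ≠ 0 ∧
      star (I : FractionalIdeal D⁰ K) =
        star ((H : FractionalIdeal D⁰ K) * (J : FractionalIdeal D⁰ K)) ∧
      (A : FractionalIdeal D⁰ K) ≤ star (H : FractionalIdeal D⁰ K) ∧
      (B : FractionalIdeal D⁰ K) ≤ star (J : FractionalIdeal D⁰ K)

lemma inv_ne_zero' {I : FractionalIdeal D⁰ K} (hI : I ≠ 0) : I⁻¹ ≠ 0 := by
  obtain ⟨d, hd, hdI⟩ := I.isFractional
  have hmem : algebraMap D K d ∈ I⁻¹ := by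
    rw [FractionalIdeal.mem_inv_iff hI]
    intro y hy
    obtain ⟨c, hc⟩ := hdI y hy
    refine ⟨c, trivial, ?_⟩
    simpa [Algebra.smul_def] using hc
  intro h0
  rw [h0] at hmem
  have : algebraMap D K d ≠ 0 :=
    IsFractionRing.to_map_ne_zero_of_mem_nonZeroDivisors hd
  exact this (by simpa using hmem)

/-- The `v`-operation `I ↦ I_v = (I⁻¹)⁻¹`. -/
noncomputable def vOp (I : FractionalIdeal D⁰ K) : FractionalIdeal D⁰ K := (I⁻¹)⁻¹

lemma vOp_mono {I J : FractionalIdeal D⁰ K} (h : I ≤ J) : vOp I ≤ vOp J := by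
  rcases eq_or_ne I 0 with rfl | hI
  · show ((0 : FractionalIdeal D⁰ K)⁻¹)⁻¹ ≤ vOp J
    rw [FractionalIdeal.inv_zero', FractionalIdeal.inv_zero']
    exact FractionalIdeal.zero_le _
  have hJ : J ≠ 0 := fun hJ0 => hI (le_antisymm (hJ0 ▸ h) (FractionalIdeal.zero_le I))
  exact FractionalIdeal.inv_anti_mono (inv_ne_zero' hJ) (inv_ne_zero' hI)
    (FractionalIdeal.inv_anti_mono hI hJ h)

/-- The `t`-operation: `I_t` is the union of `H_v` over the finitely generated
subideals `H` of `I`. -/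
noncomputable def tOp (I : FractionalIdeal D⁰ K) : FractionalIdeal D⁰ K :=
  ⟨⨆ J : {J : FractionalIdeal D⁰ K // (J : Submodule D K).FG ∧ J ≤ I},
      ((vOp (J : FractionalIdeal D⁰ K) : FractionalIdeal D⁰ K) : Submodule D K),
    FractionalIdeal.isFractional_of_le (J := vOp I)
      (iSup_le fun J => FractionalIdeal.coe_le_coe.2 (vOp_mono J.2.2))⟩

end StarSharpDefs

namespace Ideal

section Closure

variable {R : Type*} [CommRing R]

/-- The divisorial closure of an ideal, expressed through divisibility: `x` belongs to it when every
fraction `a / b` that multiplies `I` into `R` also multiplies `x` into `R`. -/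
def vClosure (I : Ideal R) : Ideal R where
  carrier := {x | ∀ a b, (∀ y ∈ I, b ∣ a * y) → b ∣ a * x}
  add_mem' hx hy a b h := by
    rw [mul_add]
    exact dvd_add (hx a b h) (hy a b h)
  zero_mem' a b _ := by simp
  smul_mem' c x hx a b h := by
    rw [smul_eq_mul, mul_left_comm]
    exact (hx a b h).mul_left c

theorem mem_vClosure {I : Ideal R} {x : R} :
    x ∈ I.vClosure ↔ ∀ a b, (∀ y ∈ I, b ∣ a * y) → b ∣ a * x :=
  Iff.rfl

theorem le_vClosure (I : Ideal R) : I ≤ I.vClosure :=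
  fun x hx _ _ h => h x hx

theorem vClosure_le_vClosure_of_le_vClosure {I J : Ideal R} (h : I ≤ J.vClosure) :
    I.vClosure ≤ J.vClosure :=
  fun _ hx a b hJ => hx a b fun _ hy => h hy a b hJ

theorem vClosure_mono {I J : Ideal R} (h : I ≤ J) : I.vClosure ≤ J.vClosure :=
  vClosure_le_vClosure_of_le_vClosure (h.trans J.le_vClosure)

theorem mul_mem_vClosure_mul {I J : Ideal R} {x y : R} (hx : x ∈ I.vClosure)
    (hy : y ∈ J.vClosure) : x * y ∈ (I * J).vClosure := by
  intro a b h
  rw [mul_comm x y, ← mul_assoc]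
  refine hx _ _ fun u hu => ?_
  rw [mul_right_comm]
  refine hy _ _ fun v hv => ?_
  rw [mul_assoc]
  exact h _ (mul_mem_mul hu hv)

/-- The union of the divisorial closures of the finitely generated subideals of an ideal. -/
def tClosure (I : Ideal R) : Ideal R where
  carrier := {x | ∃ F : Ideal R, F.FG ∧ F ≤ I ∧ x ∈ F.vClosure}
  add_mem' := by
    rintro x y ⟨F, hF, hFI, hx⟩ ⟨G, hG, hGI, hy⟩
    exact ⟨F ⊔ G, Submodule.FG.sup hF hG, sup_le hFI hGI,
      add_mem (vClosure_mono le_sup_left hx) (vClosure_mono le_sup_right hy)⟩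
  zero_mem' := ⟨⊥, Submodule.fg_bot, bot_le, zero_mem _⟩
  smul_mem' := by
    rintro c x ⟨F, hF, hFI, hx⟩
    exact ⟨F, hF, hFI, Ideal.mul_mem_left _ _ hx⟩

theorem le_tClosure (I : Ideal R) : I ≤ I.tClosure := fun x hx =>
  ⟨span {x}, Submodule.fg_span_singleton x, (span_singleton_le_iff_mem _).2 hx,
    le_vClosure _ (mem_span_singleton_self x)⟩

theorem tClosure_le_vClosure (I : Ideal R) : I.tClosure ≤ I.vClosure :=
  fun _ ⟨_, _, hFI, hx⟩ => vClosure_mono hFI hx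

theorem vClosure_le_tClosure_of_fg {I F : Ideal R} (hF : F.FG) (h : F ≤ I) :
    F.vClosure ≤ I.tClosure :=
  fun _ hx => ⟨F, hF, h, hx⟩

theorem tClosure_mono {I J : Ideal R} (h : I ≤ J) : I.tClosure ≤ J.tClosure :=
  fun _ ⟨F, hF, hFI, hx⟩ => ⟨F, hF, hFI.trans h, hx⟩

/-- If every element of a finitely generated ideal `G` lies in `Φ F` for some finitely generated
`F ≤ I`, where `Φ` is monotone, then a single `F` works for all of `G`. -/
theorem exists_fg_le_of_forall_mem {S : Type*} [CommRing S] {Φ : Ideal R → Ideal S}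
    (hΦ : Monotone Φ) {I : Ideal R} {G : Ideal S} (hG : G.FG)
    (h : ∀ x ∈ G, ∃ F : Ideal R, F.FG ∧ F ≤ I ∧ x ∈ Φ F) :
    ∃ F : Ideal R, F.FG ∧ F ≤ I ∧ G ≤ Φ F := by
  classical
  obtain ⟨s, rfl⟩ := hG
  choose! F hF hFI hxF using h
  refine ⟨s.sup F, Submodule.fg_finset_sup s F fun x hx => hF x (subset_span hx),
    Finset.sup_le fun x hx => hFI x (subset_span hx), span_le.2 fun x hx => ?_⟩
  exact hΦ (Finset.le_sup hx) (hxF x (subset_span hx))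

theorem exists_fg_le_vClosure {I G : Ideal R} (hG : G.FG) (h : G ≤ I.tClosure) :
    ∃ F : Ideal R, F.FG ∧ F ≤ I ∧ G ≤ F.vClosure :=
  exists_fg_le_of_forall_mem (fun _ _ => vClosure_mono) hG h

theorem tClosure_le_tClosure_of_le_tClosure {I J : Ideal R} (h : I ≤ J.tClosure) :
    I.tClosure ≤ J.tClosure := by
  rintro x ⟨G, hG, hGI, hx⟩
  obtain ⟨F, hF, hFJ, hGF⟩ := exists_fg_le_vClosure hG (hGI.trans h)
  exact ⟨F, hF, hFJ, vClosure_le_vClosure_of_le_vClosure hGF hx⟩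

theorem tClosure_tClosure (I : Ideal R) : I.tClosure.tClosure = I.tClosure :=
  le_antisymm (tClosure_le_tClosure_of_le_tClosure le_rfl) (le_tClosure _)

theorem mul_mem_tClosure_mul {I J : Ideal R} {x y : R} (hx : x ∈ I.tClosure)
    (hy : y ∈ J.tClosure) : x * y ∈ (I * J).tClosure := by
  obtain ⟨F, hF, hFI, hx⟩ := hx
  obtain ⟨G, hG, hGJ, hy⟩ := hy
  exact ⟨F * G, hF.mul hG, mul_mono hFI hGJ, mul_mem_vClosure_mul hx hy⟩

theorem tClosure_mul_tClosure_le (I J : Ideal R) : I.tClosure * J.tClosure ≤ (I * J).tClosure :=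
  mul_le.2 fun _ hx _ hy => mul_mem_tClosure_mul hx hy

theorem vClosure_span_singleton (x : R) : (span {x}).vClosure = span {x} := by
  refine le_antisymm (fun z hz => mem_span_singleton.2 ?_) (le_vClosure _)
  simpa using hz 1 x fun y hy => by simpa using mem_span_singleton.1 hy

theorem tClosure_span_singleton (x : R) : (span {x}).tClosure = span {x} :=
  le_antisymm ((tClosure_le_vClosure _).trans (vClosure_span_singleton x).le) (le_tClosure _)

theorem mem_tClosure_of_mul_mem [IsDomain R] {I : Ideal R} {x y : R} (hx : x ≠ 0)
    (h : x * y ∈ (span {x} * I).tClosure) : y ∈ I.tClosure := by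
  obtain ⟨F, hF, hFI, hy⟩ := h
  let m : R →ₗ[R] R := LinearMap.mulLeft R x
  have hm : Function.Injective m := mul_right_injective₀ hx
  have hFm : (Submodule.comap m F).map m = F := by
    rw [Submodule.map_comap_eq_self]
    intro z hz
    obtain ⟨w, -, rfl⟩ := mem_span_singleton_mul.1 (hFI hz)
    exact ⟨w, rfl⟩
  refine ⟨Submodule.comap m F, Submodule.fg_of_fg_map_injective m hm (hFm.symm ▸ hF), ?_, ?_⟩
  · intro z hz
    obtain ⟨w, hw, hwz⟩ := mem_span_singleton_mul.1 (hFI hz)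
    rwa [← hm hwz]
  · intro a b hab
    refine (mul_dvd_mul_iff_left hx).1 ?_
    rw [mul_left_comm]
    refine hy _ _ fun z hz => ?_
    obtain ⟨w, -, rfl⟩ := mem_span_singleton_mul.1 (hFI hz)
    rw [mul_left_comm]
    exact mul_dvd_mul_left x (hab w hz)

theorem eq_bot_of_tClosure_eq_bot {I : Ideal R} (h : I.tClosure = ⊥) : I = ⊥ :=
  le_bot_iff.1 (h ▸ le_tClosure I)

end Closure

/-- `t`-sharpness, phrased with integral ideals only. -/
def IsTSharp (R : Type*) [CommRing R] : Prop :=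
  ∀ I A B : Ideal R, I ≠ ⊥ → A ≠ ⊥ → B ≠ ⊥ → A * B ≤ I →
    ∃ H J : Ideal R, H ≠ ⊥ ∧ J ≠ ⊥ ∧ I.tClosure = (H * J).tClosure ∧
      A ≤ H.tClosure ∧ B ≤ J.tClosure

/-- Complete integral closedness: an element `a / b` of the fraction field with `(a / b) E ⊆ E`
for some nonzero ideal `E` belongs to `R`. -/
def IsCompletelyIntClosed (R : Type*) [CommRing R] : Prop :=
  ∀ E : Ideal R, E ≠ ⊥ → ∀ a b, (∀ e ∈ E, ∃ e' ∈ E, a * e = b * e') → b ∣ a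

section Sharp

variable {R : Type*} [CommRing R] [IsDomain R]

theorem IsTSharp.mem_tClosure_mul_colon (h : IsTSharp R) {A : Ideal R} {x : R} (hxA : x ∈ A)
    (hx : x ≠ 0) : x ∈ (A.vClosure * (span {x}).colon (A : Set R)).tClosure := by
  have hmem : ∀ {j}, j ∈ (span {x}).colon (A : Set R) ↔ ∀ y ∈ A, x ∣ j * y := by
    simp [Submodule.mem_colon, mem_span_singleton]
  set B := (span {x}).colon (A : Set R)
  have hxB : x ∈ B := hmem.2 fun y _ => Dvd.intro y rfl
  obtain ⟨H, J, -, -, hIHJ, hAH, hBJ⟩ := h (span {x}) A B (by simpa using hx)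
    (fun h0 => hx (by simpa [h0] using hxA)) (fun h0 => hx (by simpa [h0] using hxB))
    (mul_le.2 fun y hy j hj => by
      rw [mul_comm, mem_span_singleton]
      exact hmem.1 hj y hy)
  rw [tClosure_span_singleton] at hIHJ
  have hHJ : ∀ u ∈ H, ∀ v ∈ J, x ∣ u * v := fun u hu v hv => by
    rw [← mem_span_singleton, hIHJ]
    exact le_tClosure _ (mul_mem_mul hu hv)
  have hJB : J ≤ B := fun v hv => hmem.2 fun y hy =>
    tClosure_le_vClosure _ (hAH hy) v x fun u hu => by
      rw [mul_comm]
      exact hHJ u hu v hv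
  have hHB : ∀ u ∈ H, ∀ w ∈ B, x ∣ u * w := fun u hu w hw =>
    tClosure_le_vClosure _ (hBJ hw) u x (hHJ u hu)
  have hHA : H ≤ A.vClosure := by
    intro u hu a b hab
    obtain ⟨j, hj⟩ := hab x hxA
    rcases eq_or_ne b 0 with rfl | hb
    · have : a = 0 := by simpa [hx] using hj
      simp [this]
    have hjB : j ∈ B := hmem.2 fun y hy => by
      obtain ⟨c, hc⟩ := hab y hy
      refine ⟨c, mul_left_cancel₀ hb ?_⟩
      linear_combination (-y) * hj + x * hc
    obtain ⟨c, hc⟩ := hHB u hu j hjB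
    exact ⟨c, mul_left_cancel₀ hx (by linear_combination u * hj + b * hc)⟩
  exact tClosure_mono (mul_mono hHA hJB) (hIHJ ▸ mem_span_singleton_self x)

theorem IsTSharp.isCompletelyIntClosed (h : IsTSharp R) : IsCompletelyIntClosed R := by
  intro E hE a b hab
  obtain ⟨x, hxE, hx⟩ := Submodule.exists_mem_ne_zero_of_ne_bot hE
  have hxt := tClosure_le_vClosure _ (h.mem_tClosure_mul_colon hxE hx)
  refine (mul_dvd_mul_iff_right hx).1 (hxt a (b * x) fun y hy => ?_)
  refine Submodule.mul_induction_on hy (fun u hu j hj => ?_) fun u v hu hv => ?_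
  · rw [mul_left_comm, mul_comm u]
    refine hu _ _ fun e he => ?_
    obtain ⟨e', he', hae⟩ := hab e he
    have : x ∣ j * e' := by
      simpa [mem_span_singleton] using Submodule.mem_colon.1 hj e' he'
    rw [mul_right_comm, hae, mul_assoc, mul_comm e']
    exact mul_dvd_mul_left b this
  · rw [mul_add]
    exact dvd_add hu hv

theorem IsTSharp.mem_tClosure_mul_colon_of_fg (h : IsTSharp R) {A : Ideal R} (hA : A.FG) {x : R}
    (hxA : x ∈ A) (hx : x ≠ 0) : x ∈ (A * (span {x}).colon (A : Set R)).tClosure := by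
  refine tClosure_le_tClosure_of_le_tClosure ?_ (h.mem_tClosure_mul_colon hxA hx)
  exact (mul_mono (vClosure_le_tClosure_of_fg hA le_rfl) (le_tClosure _)).trans
    (tClosure_mul_tClosure_le _ _)

theorem IsCompletelyIntClosed.dvd_of_forall_dvd (h : IsCompletelyIntClosed R) {E : Ideal R}
    (hE : E ≠ ⊥) {a b : R}
    (hab : ∀ c d, (∀ e ∈ E, d ∣ c * e) → ∀ e ∈ E, d * b ∣ c * a * e) : b ∣ a := by
  obtain ⟨x, hxE, hx⟩ := Submodule.exists_mem_ne_zero_of_ne_bot hE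
  have hba : ∀ e ∈ E, b ∣ a * e := by simpa using hab 1 1
  rcases eq_or_ne b 0 with rfl | hb
  · have := hba x hxE
    simpa [hx] using this
  refine h E.vClosure (fun h0 => hE (le_bot_iff.1 (h0 ▸ E.le_vClosure))) a b fun e he => ?_
  obtain ⟨e', he'⟩ := he a b hba
  refine ⟨e', fun c d hcd => ?_, he'⟩
  refine (mul_dvd_mul_iff_right hb).1 ?_
  rw [mul_assoc, mul_comm e', ← he', ← mul_assoc]
  exact he _ _ (hab c d hcd)

end Sharp

end Ideal

section Transfer

variable {R F : Type*} [CommRing R] [IsDomain R] [Field F] [Algebra R F] [IsFractionRing R F]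

open Ideal

theorem vOp_coeIdeal (I : Ideal R) :
    vOp (I : FractionalIdeal R⁰ F) = (I.vClosure : FractionalIdeal R⁰ F) := by
  rcases eq_or_ne I ⊥ with rfl | hI
  · have : (⊥ : Ideal R).vClosure = ⊥ := by
      simpa using vClosure_span_singleton (0 : R)
    simp [vOp, this, FractionalIdeal.inv_zero']
  have hI' : (I : FractionalIdeal R⁰ F) ≠ 0 := FractionalIdeal.coeIdeal_ne_zero.2 hI
  have hinv : (I : FractionalIdeal R⁰ F)⁻¹ ≠ 0 := inv_ne_zero' hI'
  have hdvd : ∀ {a b y : R}, b ≠ 0 → ((algebraMap R F a / algebraMap R F b) * algebraMap R F y ∈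
      (1 : FractionalIdeal R⁰ F) ↔ b ∣ a * y) := by
    intro a b y hb
    have hb' : algebraMap R F b ≠ 0 := by simpa using hb
    rw [FractionalIdeal.mem_one_iff]
    constructor
    · rintro ⟨c, hc⟩
      refine ⟨c, IsFractionRing.injective R F ?_⟩
      rw [map_mul, map_mul, hc]
      field_simp
    · rintro ⟨c, hc⟩
      refine ⟨c, ?_⟩
      rw [div_mul_eq_mul_div, eq_div_iff hb', ← map_mul, ← map_mul, hc, mul_comm]
  have hmem : ∀ {a b : R}, b ≠ 0 → (algebraMap R F a / algebraMap R F b ∈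
      (I : FractionalIdeal R⁰ F)⁻¹ ↔ ∀ y ∈ I, b ∣ a * y) := by
    intro a b hb
    rw [FractionalIdeal.mem_inv_iff hI']
    constructor
    · intro h y hy
      exact (hdvd hb).1 (h _ (FractionalIdeal.mem_coeIdeal_of_mem _ hy))
    · intro h y hy
      obtain ⟨z, hz, rfl⟩ := (FractionalIdeal.mem_coeIdeal _).1 hy
      exact (hdvd hb).2 (h z hz)
  have key : ∀ {x : R}, algebraMap R F x ∈ vOp (I : FractionalIdeal R⁰ F) ↔ x ∈ I.vClosure := by
    intro x
    rw [vOp, FractionalIdeal.mem_inv_iff hinv, mem_vClosure]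
    constructor
    · intro h a b hab
      rcases eq_or_ne b 0 with rfl | hb
      · obtain ⟨y, hy, hy0⟩ := Submodule.exists_mem_ne_zero_of_ne_bot hI
        have := hab y hy
        have ha : a = 0 := by simpa [hy0] using this
        simp [ha]
      · have := h _ ((hmem hb).2 hab)
        rw [mul_comm] at this
        exact (hdvd hb).1 this
    · intro h z hz
      obtain ⟨a, b, hb, rfl⟩ := IsFractionRing.div_surjective (A := R) z
      have hb0 : b ≠ 0 := nonZeroDivisors.ne_zero hb
      rw [mul_comm]
      exact (hdvd hb0).2 (h a b ((hmem hb0).1 hz))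
  ext z
  rw [FractionalIdeal.mem_coeIdeal]
  constructor
  · intro hz
    have h1 : (1 : F) ∈ (I : FractionalIdeal R⁰ F)⁻¹ := by
      simpa using (hmem (a := 1) (b := 1) one_ne_zero).2 fun y _ => one_dvd _
    have hz1 := (FractionalIdeal.mem_inv_iff hinv).1 hz 1 h1
    rw [mul_one, FractionalIdeal.mem_one_iff] at hz1
    obtain ⟨x, rfl⟩ := hz1
    exact ⟨x, key.1 hz, rfl⟩
  · rintro ⟨x, hx, rfl⟩
    exact key.2 hx

theorem tOp_coeIdeal (I : Ideal R) :
    tOp (I : FractionalIdeal R⁰ F) = (I.tClosure : FractionalIdeal R⁰ F) := by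
  have hinj := IsFractionRing.injective R F
  have hdir : Directed (· ≤ ·) fun J : {J : FractionalIdeal R⁰ F //
      (J : Submodule R F).FG ∧ J ≤ (I : FractionalIdeal R⁰ F)} =>
        ((vOp (J : FractionalIdeal R⁰ F) : FractionalIdeal R⁰ F) : Submodule R F) := by
    rintro ⟨J, hJ, hJI⟩ ⟨J', hJ', hJI'⟩
    refine ⟨⟨J ⊔ J', ?_, sup_le hJI hJI'⟩, FractionalIdeal.coe_le_coe.2 (vOp_mono le_sup_left),
      FractionalIdeal.coe_le_coe.2 (vOp_mono le_sup_right)⟩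
    rw [FractionalIdeal.coe_sup]
    exact hJ.sup hJ'
  have : Nonempty {J : FractionalIdeal R⁰ F //
      (J : Submodule R F).FG ∧ J ≤ (I : FractionalIdeal R⁰ F)} :=
    ⟨0, by simpa using Submodule.fg_bot, FractionalIdeal.zero_le _⟩
  ext z
  rw [FractionalIdeal.mem_coeIdeal, ← FractionalIdeal.mem_coe, tOp, FractionalIdeal.coe_mk,
    Submodule.mem_iSup_of_directed _ hdir]
  constructor
  · rintro ⟨⟨J, hJ, hJI⟩, hz⟩
    obtain ⟨G, rfl⟩ := FractionalIdeal.le_one_iff_exists_coeIdeal.1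
      (hJI.trans FractionalIdeal.coeIdeal_le_one)
    rw [FractionalIdeal.mem_coe, vOp_coeIdeal, FractionalIdeal.mem_coeIdeal] at hz
    obtain ⟨x, hx, rfl⟩ := hz
    exact ⟨x, ⟨G, (FractionalIdeal.coeIdeal_fg R⁰ hinj G).1 hJ,
      (FractionalIdeal.coeIdeal_le_coeIdeal F).1 hJI, hx⟩, rfl⟩
  · rintro ⟨x, ⟨G, hG, hGI, hx⟩, rfl⟩
    refine ⟨⟨G, (FractionalIdeal.coeIdeal_fg R⁰ hinj G).2 hG,
      (FractionalIdeal.coeIdeal_le_coeIdeal F).2 hGI⟩, ?_⟩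
    rw [FractionalIdeal.mem_coe, vOp_coeIdeal]
    exact FractionalIdeal.mem_coeIdeal_of_mem _ hx

theorem isSharpOp_tOp_iff : IsSharpOp (D := R) (K := F) tOp ↔ IsTSharp R := by
  simp only [IsSharpOp, IsTSharp, ← FractionalIdeal.coeIdeal_mul, tOp_coeIdeal,
    FractionalIdeal.coeIdeal_le_coeIdeal, FractionalIdeal.coeIdeal_inj, Ideal.zero_eq_bot]

end Transfer

namespace Polynomial

open Ideal Polynomial

section DedekindMertens

variable {R : Type*} [CommRing R]

theorem contentIdeal_le_iff {p : R[X]} {I : Ideal R} : p.contentIdeal ≤ I ↔ ∀ n, p.coeff n ∈ I := by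
  refine ⟨fun h n => h (p.coeff_mem_contentIdeal n), fun h => ?_⟩
  rw [contentIdeal_def, span_le]
  intro x hx
  obtain ⟨n, -, rfl⟩ := mem_coeffs_iff.1 (Finset.mem_coe.1 hx)
  exact h n

theorem contentIdeal_add_le (p q : R[X]) :
    (p + q).contentIdeal ≤ p.contentIdeal + q.contentIdeal :=
  contentIdeal_le_iff.2 fun n => by
    rw [coeff_add]
    exact add_mem (mem_sup_left (p.coeff_mem_contentIdeal n))
      (mem_sup_right (q.coeff_mem_contentIdeal n))

theorem contentIdeal_neg (p : R[X]) : (-p).contentIdeal = p.contentIdeal :=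
  le_antisymm (contentIdeal_le_iff.2 fun n => by simpa using p.coeff_mem_contentIdeal n)
    (contentIdeal_le_iff.2 fun n => by simpa using (-p).coeff_mem_contentIdeal n)

theorem contentIdeal_monomial_mul_le (n : ℕ) (a : R) (p : R[X]) :
    (monomial n a * p).contentIdeal ≤ span {a} * p.contentIdeal := by
  simpa using contentIdeal_mul_le_mul_contentIdeal (monomial n a) p

theorem degree_sub_monomial_coeff_lt {p : R[X]} {n : ℕ} (h : p.degree < (n + 1 : ℕ)) :
    (p - monomial n (p.coeff n)).degree < n := by
  rw [degree_lt_iff_coeff_zero] at h ⊢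
  intro k hk
  rcases hk.eq_or_lt with rfl | hk
  · simp
  · simp [coeff_monomial, hk.ne, h k hk]

/-- A form of the **Dedekind–Mertens lemma**. -/
theorem contentIdeal_pow_mul_le (m n : ℕ) : ∀ f g : R[X], f.degree < m → g.degree < n →
    f.contentIdeal ^ (n + 1) * g.contentIdeal ≤ f.contentIdeal ^ n * (f * g).contentIdeal := by
  induction n generalizing m with
  | zero =>
    intro f g _ hg
    have : g = 0 := by simpa using hg
    simp [this]
  | succ n ihn =>
    induction m with
    | zero =>
      intro f g hf _
      have : f = 0 := by simpa using hf
      simp [this]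
    | succ m ihm =>
      intro f g hf hg
      set a := f.coeff m with ha
      set b := g.coeff n with hb
      set f' := f - monomial m a with hf'
      set g' := g - monomial n b with hg'
      set F := f.contentIdeal
      set G := g.contentIdeal
      set F' := f'.contentIdeal
      set G' := g'.contentIdeal
      set P := (f * g).contentIdeal
      have haF : span {a} ≤ F := (span_singleton_le_iff_mem _).2 (f.coeff_mem_contentIdeal m)
      have hab : span {a} * span {b} ≤ P := by
        rw [span_singleton_mul_span_singleton, span_singleton_le_iff_mem]
        have : (f * g).coeff (m + n) = a * b :=
          coeff_mul_add_eq_of_natDegree_le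
            (natDegree_le_iff_coeff_eq_zero.2 fun _ => (degree_lt_iff_coeff_zero _ _).1 hf _)
            (natDegree_le_iff_coeff_eq_zero.2 fun _ => (degree_lt_iff_coeff_zero _ _).1 hg _)
        rw [← this]
        exact coeff_mem_contentIdeal _ _
      have hF'F : F' ≤ F := by
        have := contentIdeal_add_le f (-monomial m a)
        rw [contentIdeal_neg, contentIdeal_monomial, ← sub_eq_add_neg] at this
        exact this.trans (sup_le le_rfl haF)
      have hFF' : F ≤ F' + span {a} := by
        have := contentIdeal_add_le f' (monomial m a)
        rwa [sub_add_cancel, contentIdeal_monomial] at this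
      have hGG' : G ≤ G' + span {b} := by
        have := contentIdeal_add_le g' (monomial n b)
        rwa [sub_add_cancel, contentIdeal_monomial] at this
      have hbG : span {b} ≤ G := (span_singleton_le_iff_mem _).2 (g.coeff_mem_contentIdeal n)
      have hfg' : (f * g').contentIdeal ≤ P + span {b} * F := by
        have h1 : f * g' = f * g + -(monomial n b * f) := by rw [hg']; ring
        rw [h1]
        refine (contentIdeal_add_le _ _).trans (add_le_add le_rfl ?_)
        rw [contentIdeal_neg]
        exact contentIdeal_monomial_mul_le _ _ _
      have hf'g : (f' * g).contentIdeal ≤ P + span {a} * G := by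
        have h1 : f' * g = f * g + -(monomial m a * g) := by rw [hf']; ring
        rw [h1]
        refine (contentIdeal_add_le _ _).trans (add_le_add le_rfl ?_)
        rw [contentIdeal_neg]
        exact contentIdeal_monomial_mul_le _ _ _
      have hG' : F ^ (n + 1) * G' ≤ F ^ n * P + span {b} * F ^ (n + 1) :=
        calc F ^ (n + 1) * G' ≤ F ^ n * (f * g').contentIdeal :=
              ihn (m + 1) f g' hf (degree_sub_monomial_coeff_lt hg)
          _ ≤ F ^ n * (P + span {b} * F) := mul_mono le_rfl hfg'
          _ = F ^ n * P + span {b} * F ^ (n + 1) := by ring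
      have haFP : span {a} * (F ^ n * P) ≤ F ^ (n + 1) * P :=
        calc span {a} * (F ^ n * P) ≤ F * (F ^ n * P) := mul_mono haF le_rfl
          _ = F ^ (n + 1) * P := by ring
      have habF : span {a} * span {b} * F ^ (n + 1) ≤ F ^ (n + 1) * P := by
        rw [mul_comm (F ^ (n + 1))]
        exact mul_mono hab le_rfl
      have haG : span {a} * (F ^ (n + 1) * G) ≤ F ^ (n + 1) * P :=
        calc span {a} * (F ^ (n + 1) * G)
            ≤ span {a} * (F ^ (n + 1) * (G' + span {b})) :=
              mul_mono le_rfl (mul_mono le_rfl hGG')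
          _ = span {a} * (F ^ (n + 1) * G') + span {a} * span {b} * F ^ (n + 1) := by ring
          _ ≤ span {a} * (F ^ n * P + span {b} * F ^ (n + 1)) +
              span {a} * span {b} * F ^ (n + 1) := add_le_add (mul_mono le_rfl hG') le_rfl
          _ = span {a} * (F ^ n * P) + span {a} * span {b} * F ^ (n + 1) +
              span {a} * span {b} * F ^ (n + 1) := by ring
          _ ≤ F ^ (n + 1) * P := sup_le (sup_le haFP habF) habF
      have hbF' : F' ^ (n + 2) * span {b} ≤ F ^ (n + 1) * P :=
        calc F' ^ (n + 2) * span {b} ≤ F' ^ (n + 2) * G := mul_mono le_rfl hbG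
          _ ≤ F' ^ (n + 1) * (f' * g).contentIdeal :=
              ihm f' g (degree_sub_monomial_coeff_lt hf) hg
          _ ≤ F ^ (n + 1) * (P + span {a} * G) := mul_mono (pow_right_mono hF'F _) hf'g
          _ = F ^ (n + 1) * P + span {a} * (F ^ (n + 1) * G) := by ring
          _ ≤ F ^ (n + 1) * P := sup_le le_rfl haG
      have hFpow : ∀ k, F ^ (k + 1) ≤ F' ^ (k + 1) + span {a} * F ^ k := by
        intro k
        induction k with
        | zero => simpa using hFF'
        | succ k ih =>
          calc F ^ (k + 1 + 1) = F ^ (k + 1) * F := pow_succ _ _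
            _ ≤ (F' ^ (k + 1) + span {a} * F ^ k) * F := mul_mono ih le_rfl
            _ = F' ^ (k + 1) * F + span {a} * F ^ (k + 1) := by ring
            _ ≤ F' ^ (k + 1) * (F' + span {a}) + span {a} * F ^ (k + 1) :=
              add_le_add (mul_mono le_rfl hFF') le_rfl
            _ = F' ^ (k + 1 + 1) + (span {a} * F' ^ (k + 1) + span {a} * F ^ (k + 1)) := by ring
            _ ≤ F' ^ (k + 1 + 1) + span {a} * F ^ (k + 1) :=
              add_le_add le_rfl (sup_le (mul_mono le_rfl (pow_right_mono hF'F _)) le_rfl)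
      have hbF : F ^ (n + 2) * span {b} ≤ F ^ (n + 1) * P :=
        calc F ^ (n + 2) * span {b} ≤ (F' ^ (n + 2) + span {a} * F ^ (n + 1)) * span {b} :=
              mul_mono (hFpow (n + 1)) le_rfl
          _ = F' ^ (n + 2) * span {b} + span {a} * span {b} * F ^ (n + 1) := by ring
          _ ≤ F ^ (n + 1) * P := sup_le hbF' habF
      calc F ^ (n + 1 + 1) * G ≤ F ^ (n + 2) * (G' + span {b}) := mul_mono le_rfl hGG'
        _ = F * (F ^ (n + 1) * G') + F ^ (n + 2) * span {b} := by ring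
        _ ≤ F * (F ^ n * P + span {b} * F ^ (n + 1)) + F ^ (n + 2) * span {b} :=
          add_le_add (mul_mono le_rfl hG') le_rfl
        _ = F ^ (n + 1) * P + F ^ (n + 2) * span {b} + F ^ (n + 2) * span {b} := by ring
        _ ≤ F ^ (n + 1) * P := sup_le (sup_le le_rfl hbF) hbF

end DedekindMertens

section Gauss

variable {R : Type*} [CommRing R] [IsDomain R]

/-- Gauss's lemma over a completely integrally closed domain: the content of a product has the same
divisorial closure as the product of the contents. -/
theorem coeff_mul_coeff_mem_vClosure (h : IsCompletelyIntClosed R) (f g : R[X]) (i j : ℕ) :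
    f.coeff i * g.coeff j ∈ (f * g).contentIdeal.vClosure := by
  intro a b hab
  rcases eq_or_ne f 0 with rfl | hf
  · simp
  set n := g.natDegree + 1
  have hn : g.degree < n := by
    simpa [n] using (degree_le_natDegree (p := g)).trans_lt
      (by exact_mod_cast Nat.lt_succ_self g.natDegree)
  have hm : f.degree < (f.natDegree + 1 : ℕ) := (degree_le_natDegree (p := f)).trans_lt
      (by exact_mod_cast Nat.lt_succ_self f.natDegree)
  have hne : f.contentIdeal ^ n ≠ ⊥ := pow_ne_zero n (by simpa using hf)
  refine h _ hne _ _ fun e he => ?_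
  have hmem : f.coeff i * g.coeff j * e ∈ f.contentIdeal ^ n * (f * g).contentIdeal := by
    refine contentIdeal_pow_mul_le _ _ f g hm hn ?_
    rw [mul_right_comm, pow_succ, mul_comm (f.coeff i)]
    exact mul_mem_mul (mul_mem_mul he (coeff_mem_contentIdeal _ _)) (coeff_mem_contentIdeal _ _)
  rw [mul_assoc]
  suffices ∀ z ∈ f.contentIdeal ^ n * (f * g).contentIdeal,
      ∃ e' ∈ f.contentIdeal ^ n, a * z = b * e' from this _ hmem
  intro z hz
  refine Submodule.mul_induction_on hz (fun u hu v hv => ?_) ?_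
  · obtain ⟨w, hw⟩ := hab v hv
    exact ⟨u * w, Ideal.mul_mem_right _ _ hu, by rw [mul_left_comm, hw, mul_left_comm]⟩
  · rintro u v ⟨x, hx, hux⟩ ⟨y, hy, hvy⟩
    exact ⟨x + y, add_mem hx hy, by rw [mul_add, mul_add, hux, hvy]⟩

end Gauss

section CoeffIdeal

variable {R : Type*} [CommRing R]

/-- The ideal generated by all coefficients of all members of an ideal of polynomials. -/
noncomputable def coeffIdeal (I : Ideal R[X]) : Ideal R :=
  span {x | ∃ f ∈ I, ∃ n, f.coeff n = x}

theorem coeff_mem_coeffIdeal {I : Ideal R[X]} {f : R[X]} (hf : f ∈ I) (n : ℕ) :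
    f.coeff n ∈ coeffIdeal I :=
  subset_span ⟨f, hf, n, rfl⟩

theorem coeffIdeal_le_iff {I : Ideal R[X]} {J : Ideal R} :
    coeffIdeal I ≤ J ↔ ∀ f ∈ I, ∀ n, f.coeff n ∈ J := by
  refine ⟨fun h f hf n => h (coeff_mem_coeffIdeal hf n), fun h => span_le.2 ?_⟩
  rintro _ ⟨f, hf, n, rfl⟩
  exact h f hf n

theorem coeffIdeal_le_iff_le_map_C {I : Ideal R[X]} {J : Ideal R} :
    coeffIdeal I ≤ J ↔ I ≤ J.map C := by
  rw [coeffIdeal_le_iff]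
  simp only [SetLike.le_def, mem_map_C_iff]

theorem coeffIdeal_mono : Monotone (coeffIdeal (R := R)) := fun _ _ h =>
  coeffIdeal_le_iff.2 fun _ hf n => coeff_mem_coeffIdeal (h hf) n

theorem coeffIdeal_map_C (I : Ideal R) : coeffIdeal (I.map C) = I := by
  refine le_antisymm (coeffIdeal_le_iff_le_map_C.2 le_rfl) fun x hx => ?_
  simpa using coeff_mem_coeffIdeal (mem_map_of_mem C hx) 0

theorem contentIdeal_le_coeffIdeal {I : Ideal R[X]} {f : R[X]} (hf : f ∈ I) :
    f.contentIdeal ≤ coeffIdeal I :=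
  contentIdeal_le_iff.2 (coeff_mem_coeffIdeal hf)

theorem coeffIdeal_ne_bot {I : Ideal R[X]} (hI : I ≠ ⊥) : coeffIdeal I ≠ ⊥ := fun h =>
  hI (le_bot_iff.1 (by simpa using coeffIdeal_le_iff_le_map_C.1 h.le))

theorem coeffIdeal_fg {I : Ideal R[X]} (hI : I.FG) : (coeffIdeal I).FG := by
  obtain ⟨s, rfl⟩ := hI
  have : coeffIdeal (span (s : Set R[X])) = s.sup contentIdeal := by
    refine le_antisymm (coeffIdeal_le_iff_le_map_C.2 (span_le.2 fun f hf => ?_))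
      (Finset.sup_le fun f hf => contentIdeal_le_coeffIdeal (subset_span hf))
    exact mem_map_C_iff.2 fun n => Finset.le_sup (f := contentIdeal) hf (coeff_mem_contentIdeal _ n)
  exact this ▸ Submodule.fg_finset_sup s _ fun f _ => contentIdeal_FG f

theorem exists_fg_le_coeffIdeal {I : Ideal R[X]} {G : Ideal R} (hG : G.FG)
    (h : G ≤ coeffIdeal I) : ∃ F : Ideal R[X], F.FG ∧ F ≤ I ∧ G ≤ coeffIdeal F := by
  refine exists_fg_le_of_forall_mem coeffIdeal_mono hG fun x hx => ?_
  refine Submodule.span_induction ?_ ?_ ?_ ?_ (h hx)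
  · rintro _ ⟨f, hf, n, rfl⟩
    exact ⟨span {f}, Submodule.fg_span_singleton f, (span_singleton_le_iff_mem _).2 hf,
      coeff_mem_coeffIdeal (mem_span_singleton_self f) n⟩
  · exact ⟨⊥, Submodule.fg_bot, bot_le, zero_mem _⟩
  · rintro x y - - ⟨F, hF, hFI, hx⟩ ⟨F', hF', hFI', hy⟩
    exact ⟨F ⊔ F', Submodule.FG.sup hF hF', sup_le hFI hFI',
      add_mem (coeffIdeal_mono le_sup_left hx) (coeffIdeal_mono le_sup_right hy)⟩
  · rintro c x - ⟨F, hF, hFI, hx⟩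
    exact ⟨F, hF, hFI, Ideal.mul_mem_left _ c hx⟩

theorem coeff_mem_tClosure_coeffIdeal {I : Ideal R[X]} {f : R[X]} (hf : f ∈ I.tClosure) (n : ℕ) :
    f.coeff n ∈ (coeffIdeal I).tClosure := by
  obtain ⟨F, hF, hFI, hf⟩ := hf
  refine ⟨coeffIdeal F, coeffIdeal_fg hF, coeffIdeal_mono hFI, fun a b hab => ?_⟩
  have := hf (C a) (C b) fun p hp => (C_dvd_iff_dvd_coeff _ _).2 fun k => by
    simpa using hab _ (coeff_mem_coeffIdeal hp k)
  simpa using (C_dvd_iff_dvd_coeff _ _).1 this n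

theorem coeffIdeal_mul_le [IsDomain R] (h : IsCompletelyIntClosed R) (I J : Ideal R[X]) :
    coeffIdeal I * coeffIdeal J ≤ (coeffIdeal (I * J)).tClosure := by
  rw [coeffIdeal, coeffIdeal, span_mul_span', span_le]
  rintro _ ⟨_, ⟨f, hf, i, rfl⟩, _, ⟨g, hg, j, rfl⟩, rfl⟩
  exact ⟨(f * g).contentIdeal, contentIdeal_FG _, contentIdeal_le_coeffIdeal (mul_mem_mul hf hg),
    coeff_mul_coeff_mem_vClosure h f g i j⟩

end CoeffIdeal

section FractionField

variable {R : Type*} [CommRing R]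

theorem map_injective_algebraMap (K : Type*) [Field K] [Algebra R K] [IsFractionRing R K] :
    Function.Injective (map (algebraMap R K)) :=
  map_injective _ (IsFractionRing.injective R K)

theorem isUnit_C_algebraMap (K : Type*) [Field K] [Algebra R K] [IsFractionRing R K] {s : R}
    (hs : s ≠ 0) : IsUnit (C (algebraMap R K s)) :=
  isUnit_C.2 (by simpa using hs)

variable [IsDomain R]

theorem exists_map_eq_C_mul {K : Type*} [Field K] [Algebra R K] [IsFractionRing R K] (k : K[X]) :
    ∃ s : R, s ≠ 0 ∧ ∃ p : R[X], p.map (algebraMap R K) = C (algebraMap R K s) * k := by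
  obtain ⟨s, hs, h⟩ := IsLocalization.integerNormalization_spec R⁰ k
  exact ⟨s, nonZeroDivisors.ne_zero hs, _, by rw [h, Algebra.smul_def]; rfl⟩

theorem map_dvd_map_iff_exists (K : Type*) [Field K] [Algebra R K] [IsFractionRing R K]
    {p q : R[X]} : p.map (algebraMap R K) ∣ q.map (algebraMap R K) ↔ ∃ s ≠ 0, p ∣ C s * q := by
  constructor
  · rintro ⟨k, hk⟩
    obtain ⟨s, hs, r, hr⟩ := exists_map_eq_C_mul (R := R) k
    refine ⟨s, hs, r, map_injective_algebraMap K ?_⟩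
    rw [Polynomial.map_mul, Polynomial.map_mul, hr, hk, map_C]
    ring
  · rintro ⟨s, hs, h⟩
    have := map_dvd (algebraMap R K) h
    rwa [Polynomial.map_mul, map_C, (isUnit_C_algebraMap K hs).dvd_mul_left] at this

theorem exists_mem_map_eq_C_mul {K : Type*} [Field K] [Algebra R K] [IsFractionRing R K]
    {I : Ideal R[X]} {k : K[X]} (hk : k ∈ I.map (mapRingHom (algebraMap R K))) :
    ∃ s : R, s ≠ 0 ∧ ∃ p ∈ I, p.map (algebraMap R K) = C (algebraMap R K s) * k := by
  refine Submodule.span_induction ?_ ?_ ?_ ?_ hk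
  · rintro _ ⟨p, hp, rfl⟩
    exact ⟨1, one_ne_zero, p, hp, by simp⟩
  · exact ⟨1, one_ne_zero, 0, zero_mem I, by simp⟩
  · rintro x y - - ⟨s, hs, p, hp, hpx⟩ ⟨t, ht, q, hq, hqy⟩
    refine ⟨s * t, mul_ne_zero hs ht, C t * p + C s * q,
      add_mem (Ideal.mul_mem_left _ _ hp) (Ideal.mul_mem_left _ _ hq), ?_⟩
    simp only [Polynomial.map_add, Polynomial.map_mul, map_C, hpx, hqy, map_mul]
    ring
  · rintro a x - ⟨s, hs, p, hp, hpx⟩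
    obtain ⟨t, ht, q, hq⟩ := exists_map_eq_C_mul (R := R) a
    refine ⟨s * t, mul_ne_zero hs ht, q * p, Ideal.mul_mem_left _ _ hp, ?_⟩
    simp only [Polynomial.map_mul, hpx, hq, map_mul, smul_eq_mul]
    ring

/-- Up to nonzero constants, every nonzero ideal of `R[X]` is generated by one of its members. -/
theorem exists_mem_forall_dvd_C_mul {I : Ideal R[X]} (hI : I ≠ ⊥) :
    ∃ h ∈ I, h ≠ 0 ∧ ∀ f ∈ I, ∃ s ≠ 0, h ∣ C s * f := by
  let K := FractionRing R
  obtain ⟨k, hk⟩ := IsPrincipalIdealRing.principal (I.map (mapRingHom (algebraMap R K)))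
  obtain ⟨s, hs, h, hhI, hh⟩ := exists_mem_map_eq_C_mul (R := R) (K := K) (k := k)
    (by rw [hk]; exact Submodule.mem_span_singleton_self k)
  have hdvd : ∀ f ∈ I, h.map (algebraMap R K) ∣ f.map (algebraMap R K) := fun f hf => by
    rw [hh, (isUnit_C_algebraMap K hs).mul_left_dvd]
    have := mem_map_of_mem (mapRingHom (algebraMap R K)) hf
    rw [hk] at this
    exact Ideal.mem_span_singleton.1 this
  refine ⟨h, hhI, ?_, fun f hf => (map_dvd_map_iff_exists K).1 (hdvd f hf)⟩
  rintro rfl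
  obtain ⟨f, hf, hf0⟩ := Submodule.exists_mem_ne_zero_of_ne_bot hI
  have := hdvd f hf
  rw [Polynomial.map_zero, zero_dvd_iff] at this
  exact hf0 (map_injective_algebraMap K (by simpa using this))

theorem exists_dvd_C_mul_of_dvd_mul {p f g : R[X]} (h : p ∣ f * g) :
    ∃ q r : R[X], (∃ s ≠ 0, q ∣ C s * f) ∧ (∃ s ≠ 0, r ∣ C s * g) ∧
      (∃ s ≠ 0, p ∣ C s * (q * r)) ∧ ∃ s ≠ 0, q * r ∣ C s * p := by
  let K := FractionRing R
  have h' := map_dvd (algebraMap R K) h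
  rw [Polynomial.map_mul] at h'
  obtain ⟨k, l, hk, hl, hkl⟩ := exists_dvd_and_dvd_of_dvd_mul h'
  obtain ⟨s, hs, q, hq⟩ := exists_map_eq_C_mul (R := R) k
  obtain ⟨t, ht, r, hr⟩ := exists_map_eq_C_mul (R := R) l
  have hs' := isUnit_C_algebraMap K hs
  have ht' := isUnit_C_algebraMap K ht
  have hqr : (q * r).map (algebraMap R K) =
      C (algebraMap R K s) * (C (algebraMap R K t) * p.map (algebraMap R K)) := by
    rw [Polynomial.map_mul, hq, hr, hkl]
    ring
  simp only [← map_dvd_map_iff_exists K]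
  refine ⟨q, r, ?_, ?_, ?_, ?_⟩
  · rwa [hq, hs'.mul_left_dvd]
  · rwa [hr, ht'.mul_left_dvd]
  · rw [hqr, hs'.dvd_mul_left, ht'.dvd_mul_left]
  · rw [hqr, hs'.mul_left_dvd, ht'.mul_left_dvd]

theorem exists_dvd_C_mul_trans {p q r : R[X]} (hpq : ∃ s ≠ 0, p ∣ C s * q)
    (hqr : ∃ s ≠ 0, q ∣ C s * r) : ∃ s ≠ 0, p ∣ C s * r := by
  obtain ⟨s, hs, hpq⟩ := hpq
  obtain ⟨t, ht, hqr⟩ := hqr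
  refine ⟨s * t, mul_ne_zero hs ht, hpq.trans ?_⟩
  rw [C_mul, mul_assoc]
  exact mul_dvd_mul_left _ hqr

theorem exists_dvd_C_mul_mul {p q f g : R[X]} (hpf : ∃ s ≠ 0, p ∣ C s * f)
    (hqg : ∃ s ≠ 0, q ∣ C s * g) : ∃ s ≠ 0, p * q ∣ C s * (f * g) := by
  obtain ⟨s, hs, hpf⟩ := hpf
  obtain ⟨t, ht, hqg⟩ := hqg
  refine ⟨s * t, mul_ne_zero hs ht, ?_⟩
  rw [C_mul, mul_mul_mul_comm]
  exact mul_dvd_mul hpf hqg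

end FractionField

section TClosure

variable {R : Type*} [CommRing R] [IsDomain R]

theorem mem_tClosure_of_coeff_mem (h : IsCompletelyIntClosed R) {I : Ideal R[X]} {f : R[X]}
    (hs : ∃ s ≠ 0, C s * f ∈ I) (hf : f.contentIdeal ≤ (coeffIdeal I).tClosure) :
    f ∈ I.tClosure := by
  obtain ⟨s, hs, hsI⟩ := hs
  obtain ⟨G, hG, hGI, hfG⟩ := exists_fg_le_vClosure (contentIdeal_FG f) hf
  obtain ⟨F, hF, hFI, hGF⟩ := exists_fg_le_coeffIdeal hG hGI
  have hfF : ∀ n, f.coeff n ∈ (coeffIdeal F).vClosure := fun n =>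
    vClosure_mono hGF (hfG (coeff_mem_contentIdeal f n))
  refine ⟨F ⊔ span {C s * f}, Submodule.FG.sup hF (Submodule.fg_span_singleton _),
    sup_le hFI ((span_singleton_le_iff_mem _).2 hsI), fun a b hab => ?_⟩
  rcases eq_or_ne f 0 with rfl | hf0
  · simp
  have hF0 : coeffIdeal F ≠ ⊥ := by
    intro h0
    refine hf0 (ext fun n => ?_)
    have := hfF n
    rw [h0, ← Ideal.span_singleton_zero, vClosure_span_singleton] at this
    simpa using this
  have hs' : (C s : R[X]) ≠ 0 := C_ne_zero.2 hs
  obtain ⟨c, hc⟩ := hab _ (mem_sup_right (mem_span_singleton_self _))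
  rcases eq_or_ne b 0 with rfl | hb
  · have : a = 0 := by simpa [hs, hf0] using hc
    simp [this]
  suffices hsc : C s ∣ c by
    obtain ⟨c', rfl⟩ := hsc
    exact ⟨c', mul_left_cancel₀ hs' (by linear_combination hc)⟩
  refine (C_dvd_iff_dvd_coeff _ _).2 fun i => h.dvd_of_forall_dvd hF0 fun u d hud => ?_
  suffices coeffIdeal F ≤ (span {d * s}).colon {u * c.coeff i} from fun e he => by
    simpa [mem_span_singleton, Submodule.mem_colon_singleton, mul_comm e] using this he
  refine coeffIdeal_le_iff.2 fun p hp j => ?_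
  rw [Submodule.mem_colon_singleton, mem_span_singleton, smul_eq_mul]
  obtain ⟨q, hq⟩ := hab p (mem_sup_left hp)
  have hcp : c * p = C s * (f * q) := by
    rcases eq_or_ne a 0 with rfl | ha
    · have hc0 : c = 0 := by simpa [hb] using hc.symm
      have hq0 : q = 0 := by simpa [hb] using hq.symm
      simp [hc0, hq0]
    · exact mul_left_cancel₀ (mul_ne_zero ha hb) (by
        linear_combination (-a * p) * hc + (a * C s * f) * hq)
  have hdf : C d ∣ C u * f := (C_dvd_iff_dvd_coeff _ _).2 fun n => by
    simpa using hfF n u d hud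
  have hdcp : C (d * s) ∣ C u * (c * p) := by
    rw [hcp, C_mul, mul_left_comm, ← mul_assoc (C u), mul_comm (C d)]
    exact mul_dvd_mul_left _ (hdf.mul_right q)
  rw [mul_left_comm, mul_comm (p.coeff j)]
  refine coeff_mul_coeff_mem_vClosure h c p i j u (d * s) ?_
  intro y hy
  suffices (c * p).contentIdeal ≤ (span {d * s}).colon {u} by
    simpa [mem_span_singleton, Submodule.mem_colon_singleton, mul_comm y] using this hy
  refine contentIdeal_le_iff.2 fun n => ?_
  rw [Submodule.mem_colon_singleton, mem_span_singleton, smul_eq_mul, mul_comm _ u]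
  simpa using (C_dvd_iff_dvd_coeff _ _).1 hdcp n

end TClosure

end Polynomial

namespace Ideal

open Polynomial

variable {R : Type*} [CommRing R]

theorem map_C_ne_bot {I : Ideal R} (hI : I ≠ ⊥) : I.map (C : R →+* R[X]) ≠ ⊥ :=
  (Ideal.map_eq_bot_iff_of_injective C_injective).not.2 hI

theorem IsCompletelyIntClosed.of_polynomial (h : IsCompletelyIntClosed R[X]) :
    IsCompletelyIntClosed R := by
  intro E hE a b hab
  suffices C b ∣ C a by simpa using (C_dvd_iff_dvd_coeff _ _).1 this 0
  refine h (E.map C) (map_C_ne_bot hE) _ _ fun e he => ?_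
  choose! φ hφE hφ using hab
  refine Submodule.span_induction ?_ ?_ ?_ ?_ he
  · rintro _ ⟨x, hx, rfl⟩
    exact ⟨C (φ x), mem_map_of_mem C (hφE x hx), by rw [← C_mul, ← C_mul, hφ x hx]⟩
  · exact ⟨0, zero_mem _, by simp⟩
  · rintro x y - - ⟨x', hx', hx⟩ ⟨y', hy', hy⟩
    exact ⟨x' + y', add_mem hx' hy', by rw [mul_add, mul_add, hx, hy]⟩
  · rintro c x - ⟨x', hx', hx⟩
    exact ⟨c * x', Ideal.mul_mem_left _ _ hx', by
      rw [smul_eq_mul, mul_left_comm, hx, mul_left_comm]⟩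

variable [IsDomain R]

theorem IsTSharp.of_polynomial (h : IsTSharp R[X]) : IsTSharp R := by
  have hc := h.isCompletelyIntClosed.of_polynomial
  have hle : ∀ {I : Ideal R} {J : Ideal R[X]}, I.map C ≤ J.tClosure →
      I ≤ (coeffIdeal J).tClosure := fun hIJ x hx => by
    simpa using coeff_mem_tClosure_coeffIdeal (hIJ (mem_map_of_mem C hx)) 0
  intro I A B hI hA hB hAB
  obtain ⟨H, J, hH, hJ, hIHJ, hAH, hBJ⟩ := h (I.map C) (A.map C) (B.map C) (map_C_ne_bot hI)
    (map_C_ne_bot hA) (map_C_ne_bot hB) (by rw [← Ideal.map_mul]; exact map_mono hAB)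
  refine ⟨coeffIdeal H, coeffIdeal J, coeffIdeal_ne_bot hH, coeffIdeal_ne_bot hJ,
    le_antisymm ?_ ?_, hle hAH, hle hBJ⟩
  · have hIc : I ≤ (coeffIdeal (H * J)).tClosure := hle (hIHJ ▸ le_tClosure _)
    refine tClosure_le_tClosure_of_le_tClosure (hIc.trans (tClosure_mono ?_))
    refine coeffIdeal_le_iff.2 fun f hf n => ?_
    refine contentIdeal_le_iff.1 ?_ n
    refine Submodule.mul_induction_on hf (fun u hu v hv => ?_) fun u v hu hv => ?_
    · exact (contentIdeal_mul_le_mul_contentIdeal u v).trans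
        (mul_mono (contentIdeal_le_coeffIdeal hu) (contentIdeal_le_coeffIdeal hv))
    · exact (contentIdeal_add_le u v).trans (sup_le hu hv)
  · refine tClosure_le_tClosure_of_le_tClosure ((coeffIdeal_mul_le hc H J).trans ?_)
    refine tClosure_le_tClosure_of_le_tClosure (coeffIdeal_le_iff.2 fun f hf n => ?_)
    have hfI : f ∈ (I.map C).tClosure := hIHJ ▸ le_tClosure _ hf
    simpa only [coeffIdeal_map_C] using coeff_mem_tClosure_coeffIdeal hfI n

/-- The polynomials that are multiples of `h` up to a nonzero constant and whose coefficients lie in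
`H`. -/
def multiplesWithCoeff (h : R[X]) (H : Ideal R) : Ideal R[X] where
  carrier := {f | (∃ s ≠ 0, h ∣ C s * f) ∧ f ∈ H.map C}
  add_mem' := by
    rintro f g ⟨⟨s, hs, hf⟩, hfH⟩ ⟨⟨t, ht, hg⟩, hgH⟩
    refine ⟨⟨s * t, mul_ne_zero hs ht, ?_⟩, add_mem hfH hgH⟩
    rw [mul_add, C_mul, mul_assoc, mul_assoc, mul_left_comm]
    exact dvd_add (hf.mul_left _) (hg.mul_left _)
  zero_mem' := ⟨⟨1, one_ne_zero, by simp⟩, zero_mem _⟩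
  smul_mem' := by
    rintro c f ⟨⟨s, hs, hf⟩, hfH⟩
    refine ⟨⟨s, hs, ?_⟩, Ideal.mul_mem_left _ c hfH⟩
    rw [smul_eq_mul, mul_left_comm]
    exact hf.mul_left c

theorem mem_multiplesWithCoeff {h f : R[X]} {H : Ideal R} :
    f ∈ multiplesWithCoeff h H ↔ (∃ s ≠ 0, h ∣ C s * f) ∧ f ∈ H.map C :=
  Iff.rfl

theorem mul_mem_multiplesWithCoeff {h g : R[X]} {H : Ideal R} (hg : h ∣ g) {y : R} (hy : y ∈ H) :
    C y * g ∈ multiplesWithCoeff h H :=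
  ⟨⟨1, one_ne_zero, by simpa using hg.mul_left _⟩, Ideal.mul_mem_right _ _ (mem_map_of_mem C hy)⟩

theorem IsTSharp.le_tClosure_coeffIdeal_multiplesWithCoeff (hR : IsTSharp R) {h : R[X]}
    (hh : h ≠ 0) (H : Ideal R) : H ≤ (coeffIdeal (multiplesWithCoeff h H)).tClosure := by
  intro y hy
  have hlc : h.leadingCoeff ≠ 0 := leadingCoeff_ne_zero.2 hh
  set x := h.leadingCoeff
  have hx : x ∈ (h.contentIdeal * (span {x}).colon h.contentIdeal).tClosure :=
    hR.mem_tClosure_mul_colon_of_fg (contentIdeal_FG h) (coeff_mem_contentIdeal h _) hlc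
  refine mem_tClosure_of_mul_mem hlc ?_
  rw [mul_comm x]
  refine tClosure_mono ?_ (mul_mem_tClosure_mul (le_tClosure _ (mem_span_singleton_self y)) hx)
  rw [mul_comm h.contentIdeal, ← mul_assoc]
  refine mul_le.2 fun u hu v hv => ?_
  obtain ⟨j, hj, rfl⟩ := mem_span_singleton_mul.1 hu
  suffices h.contentIdeal ≤ Submodule.colon (span {x} * coeffIdeal (multiplesWithCoeff h H))
      {y * j} by
    simpa [Submodule.mem_colon_singleton, mul_comm] using this hv
  refine contentIdeal_le_iff.2 fun n => Submodule.mem_colon_singleton.2 ?_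
  have hjh : C x ∣ C j * h := (C_dvd_iff_dvd_coeff _ _).2 fun k => by
    simpa [mem_span_singleton] using Submodule.mem_colon.1 hj _ (coeff_mem_contentIdeal h k)
  obtain ⟨g, hg⟩ := hjh
  have hxg : C y * g ∈ multiplesWithCoeff h H :=
    ⟨⟨x, hlc, by rw [mul_left_comm, ← hg]; exact (dvd_mul_left _ _).mul_left _⟩,
      Ideal.mul_mem_right _ _ (mem_map_of_mem C hy)⟩
  refine mem_span_singleton_mul.2 ⟨_, coeff_mem_coeffIdeal hxg n, ?_⟩
  have := congrArg (fun p => p.coeff n) hg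
  simp only [coeff_C_mul] at this
  rw [coeff_C_mul, smul_eq_mul]
  linear_combination (-y) * this

theorem IsTSharp.mul_le_tClosure_coeffIdeal_multiplesWithCoeff_mul (hR : IsTSharp R) {q r : R[X]}
    (hq : q ≠ 0) (hr : r ≠ 0) (H J : Ideal R) :
    H * J ≤ (coeffIdeal (multiplesWithCoeff q H * multiplesWithCoeff r J)).tClosure :=
  (mul_mono (hR.le_tClosure_coeffIdeal_multiplesWithCoeff hq H)
    (hR.le_tClosure_coeffIdeal_multiplesWithCoeff hr J)).trans <|
    (tClosure_mul_tClosure_le _ _).trans <|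
      tClosure_le_tClosure_of_le_tClosure (coeffIdeal_mul_le hR.isCompletelyIntClosed _ _)

theorem multiplesWithCoeff_mul_le_tClosure (hR : IsCompletelyIntClosed R) {I : Ideal R[X]}
    {i q r : R[X]} (hiI : i ∈ I) (hi : ∃ s ≠ 0, i ∣ C s * (q * r)) {H J : Ideal R}
    (hHJ : H * J ≤ (coeffIdeal I).tClosure) :
    multiplesWithCoeff q H * multiplesWithCoeff r J ≤ I.tClosure := by
  refine mul_le.2 fun f hf g hg => ?_
  rw [mem_multiplesWithCoeff, mem_map_C_iff, ← contentIdeal_le_iff] at hf hg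
  obtain ⟨t, ht, hdvd⟩ := exists_dvd_C_mul_trans hi (exists_dvd_C_mul_mul hf.1 hg.1)
  exact mem_tClosure_of_coeff_mem hR ⟨t, ht, Ideal.mem_of_dvd _ hdvd hiI⟩
    ((contentIdeal_mul_le_mul_contentIdeal f g).trans ((mul_mono hf.2 hg.2).trans hHJ))

theorem IsTSharp.polynomial (hR : IsTSharp R) : IsTSharp R[X] := by
  have hc := hR.isCompletelyIntClosed
  intro I A B hI hA hB hAB
  obtain ⟨i, hiI, hi0, hi⟩ := exists_mem_forall_dvd_C_mul hI
  obtain ⟨α, hαA, hα0, hα⟩ := exists_mem_forall_dvd_C_mul hA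
  obtain ⟨β, hβB, hβ0, hβ⟩ := exists_mem_forall_dvd_C_mul hB
  obtain ⟨s, hs, hiαβ⟩ := hi _ (hAB (mul_mem_mul hαA hβB))
  rw [← mul_assoc] at hiαβ
  obtain ⟨q, r, hq, hr, hiqr, hqri⟩ := exists_dvd_C_mul_of_dvd_mul hiαβ
  replace hq : ∃ s ≠ 0, q ∣ C s * α := exists_dvd_C_mul_trans hq ⟨s, hs, dvd_rfl⟩
  have hne : q * r ≠ 0 := by
    rintro h0
    obtain ⟨t, ht, hqri⟩ := hqri
    rw [h0, zero_dvd_iff] at hqri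
    simp [ht, hi0] at hqri
  have hq0 := left_ne_zero_of_mul hne
  have hr0 := right_ne_zero_of_mul hne
  obtain ⟨H, J, hH, hJ, hIHJ, hAH, hBJ⟩ := hR (coeffIdeal I).tClosure (coeffIdeal A) (coeffIdeal B)
    (fun h0 => coeffIdeal_ne_bot hI (eq_bot_of_tClosure_eq_bot h0)) (coeffIdeal_ne_bot hA)
    (coeffIdeal_ne_bot hB)
    ((coeffIdeal_mul_le hc A B).trans (tClosure_mono (coeffIdeal_mono hAB)))
  rw [tClosure_tClosure] at hIHJ
  obtain ⟨y, hyH, hy0⟩ := Submodule.exists_mem_ne_zero_of_ne_bot hH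
  obtain ⟨z, hzJ, hz0⟩ := Submodule.exists_mem_ne_zero_of_ne_bot hJ
  let H' := multiplesWithCoeff q H.tClosure
  let J' := multiplesWithCoeff r J.tClosure
  have hyq : C y * q ∈ H' := mul_mem_multiplesWithCoeff dvd_rfl (le_tClosure _ hyH)
  have hzr : C z * r ∈ J' := mul_mem_multiplesWithCoeff dvd_rfl (le_tClosure _ hzJ)
  have hsub : H' * J' ≤ I.tClosure :=
    multiplesWithCoeff_mul_le_tClosure hc hiI hiqr
      ((tClosure_mul_tClosure_le H J).trans hIHJ.ge)
  have hcoeff : (coeffIdeal I).tClosure ≤ (coeffIdeal (H' * J')).tClosure := by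
    rw [hIHJ]
    exact tClosure_le_tClosure_of_le_tClosure ((mul_mono (le_tClosure H) (le_tClosure J)).trans
      (hR.mul_le_tClosure_coeffIdeal_multiplesWithCoeff_mul hq0 hr0 _ _))
  refine ⟨H', J', ?_, ?_, le_antisymm ?_ (tClosure_le_tClosure_of_le_tClosure hsub), ?_, ?_⟩
  · exact fun h0 => mul_ne_zero (C_ne_zero.2 hy0) hq0 (by simpa [h0] using hyq)
  · exact fun h0 => mul_ne_zero (C_ne_zero.2 hz0) hr0 (by simpa [h0] using hzr)
  · refine tClosure_le_tClosure_of_le_tClosure fun f hf => ?_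
    refine mem_tClosure_of_coeff_mem hc ?_
      (((contentIdeal_le_coeffIdeal hf).trans (le_tClosure _)).trans hcoeff)
    obtain ⟨t, ht, hdvd⟩ := exists_dvd_C_mul_trans hqri (hi f hf)
    refine ⟨y * z * t, mul_ne_zero (mul_ne_zero hy0 hz0) ht, ?_⟩
    refine Ideal.mem_of_dvd _ ?_ (mul_mem_mul hyq hzr)
    rw [mul_mul_mul_comm, ← C_mul, C_mul (a := y * z), mul_assoc]
    exact mul_dvd_mul_left _ hdvd
  · exact fun f hf => le_tClosure _ <| mem_multiplesWithCoeff.2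
      ⟨exists_dvd_C_mul_trans hq (hα f hf), mem_map_C_iff.2 fun n => hAH (coeff_mem_coeffIdeal hf n)⟩
  · exact fun f hf => le_tClosure _ <| mem_multiplesWithCoeff.2
      ⟨exists_dvd_C_mul_trans hr (hβ f hf), mem_map_C_iff.2 fun n => hBJ (coeff_mem_coeffIdeal hf n)⟩

end Ideal

/-- A domain `D` is `t`-sharp if and only if the polynomial ring
`D[X]` is `t`-sharp. -/
theorem statement16 (D : Type*) [CommRing D] [IsDomain D]
    (K : Type*) [Field K] [Algebra D K] [IsFractionRing D K]
    (L : Type*) [Field L] [Algebra (Polynomial D) L] [IsFractionRing (Polynomial D) L] :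
    IsSharpOp (D := D) (K := K) tOp ↔ IsSharpOp (D := Polynomial D) (K := L) tOp := by
  rw [isSharpOp_tOp_iff, isSharpOp_tOp_iff]
  exact ⟨Ideal.IsTSharp.polynomial, Ideal.IsTSharp.of_polynomial⟩
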